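/- Let α, β, γ ∈ ℂ with α + β + γ = 0 and α, β, γ all nonzero, let m ≥ 3 be an integer, let a₁,…,a₁₀, C ∈ ℂ, and set Q(z) = a₁(z¹)^{2m} + a₂(z²)^{2m} + a₃(z³)^{2m} + a₄(z⁴)^{2m} + a₅(z¹)^m(z²)^m + a₆(z¹)^m(z⁴)^m + a₇(z²)^m(z³)^m + a₈(z³)^m(z⁴)^m + a₉(z¹)^m(z³)^m + a₁₀(z²)^m(z⁴)^m + C. Suppose u : U → ℂ is twice continuously differentiable on a nonempty connected open set U ⊆ ℂ⁴, u(z) ≠ 0 and u(z)^{2m} = Q(z) on U, u satisfies the general heavenly equation α u_{12}u_{34} + β u_{13}u_{24} + γ u_{14}u_{23} = 0 on U, and Δ = u_{13}u_{24} − u_{14}u_{23} is not identically zero on U. Then the coefficients satisfy one of the two sets of relations: either (i) a₇ = −(αa₅a₈ + βa₉a₁₀)/(γa₆), a₁ = [a₆(αa₉a₁₀ + βa₅a₈) + 2γa₄a₅a₉]/[2γ(2a₄a₇ − a₈a₁₀)], a₂ = [αa₁₀(a₅a₈ − a₉a₁₀) + γa₅(2a₄a₇ − a₈a₁₀)]/[2γ(2a₄a₉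 − a₆a₈)], a₃ = [βa₈(a₅a₈ − a₉a₁₀) − γa₉(2a₄a₇ − a₈a₁₀)]/[2γ(a₆a₁₀ − 2a₄a₅)]; or (ii) a₆ = 0, a₁₀ = −αa₅a₈/(βa₉), a₁ = βa₄a₅a₉²/(αa₅a₈² + 2βa₄a₇a₉), a₂ = a₅(2β²a₄a₇a₉ − αγa₅a₈²)/(4β²a₄a₉²), a₃ = (2βa₄a₇a₉ − γa₅a₈²)/(4βa₄a₅) (in each case with the denominators nonzero). -/

import Mathlib

/-!  Coordinates: `z : Fin 4 → ℂ` with paper indices `z¹,z²,z³,z⁴` corresponding to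
`z 0, z 1, z 2, z 3`.  `pd i f` is the partial derivative ∂f/∂zⁱ. -/

/-- Partial derivative of `f : ℂ⁴ → ℂ` in the `i`-th coordinate direction. -/
noncomputable def pd (i : Fin 4) (f : (Fin 4 → ℂ) → ℂ) : (Fin 4 → ℂ) → ℂ :=
  fun z => fderiv ℂ f z (Pi.single i 1)

/-- The polynomial `Q(z) = a₁(z¹)^{2m} + a₂(z²)^{2m} + a₃(z³)^{2m} + a₄(z⁴)^{2m}
+ a₅(z¹)^m(z²)^m + a₆(z¹)^m(z⁴)^m + a₇(z²)^m(z³)^m + a₈(z³)^m(z⁴)^m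
+ a₉(z¹)^m(z³)^m + a₁₀(z²)^m(z⁴)^m + C`. -/
noncomputable def Qpoly (m : ℕ) (a1 a2 a3 a4 a5 a6 a7 a8 a9 a10 C : ℂ)
    (z : Fin 4 → ℂ) : ℂ :=
  a1 * (z 0) ^ (2 * m) + a2 * (z 1) ^ (2 * m) + a3 * (z 2) ^ (2 * m) + a4 * (z 3) ^ (2 * m)
    + a5 * (z 0) ^ m * (z 1) ^ m + a6 * (z 0) ^ m * (z 3) ^ m
    + a7 * (z 1) ^ m * (z 2) ^ m + a8 * (z 2) ^ m * (z 3) ^ m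
    + a9 * (z 0) ^ m * (z 2) ^ m + a10 * (z 1) ^ m * (z 3) ^ m + C

/-- rank 3 case -/
lemma key3 (α β γ : ℂ) (h0 : α + β + γ = 0) (hα : α ≠ 0) (hβ : β ≠ 0) (hγ : γ ≠ 0)
  (a1 a2 a3 a5 a6 a7 a8 a9 a10 c1 c2 c3 : ℂ)
  (hm : 4*a1*a2*a3*2 + 2*a5*a7*a9 - 2*a1*a7^2 - 2*a2*a9^2-2*a3*a5^2 ≠ 0)
  (r1 : a6 = 2*a1*c1+a5*c2+a9*c3) (r2 : a10 = a5*c1+2*a2*c2+a7*c3) (r3 : a8 = a9*c1+a7*c2+2*a3*c3)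
  (e1 : c1 * a7 = 0) (e2 : c2*a9=0) (e3 : c3 * a5 = 0)
  (e4 : α*a8 + c1*β*a9+c2*γ*a7 = 0) (e5 : β*a10 + c1*α*a5+c3*γ*a7=0)
  (e6 : γ*a6+c2*α*a5+c3*β*a9=0) : (c1 = 0 ∧ c2 = 0 ∧ c3 = 0) ∨
   (a5 = 0 ∧ a6 = 0 ∧ a7 = 0 ∧ a8 = 0 ∧ a9=0 ∧ a10=0) := by
  have main : ∀ (α β γ : ℂ) (h0 : α + β + γ = 0) (hα : α ≠ 0) (hβ : β ≠ 0) (hγ : γ ≠ 0)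
    (a1 a2 a3 a7 c2 c3 : ℂ) (h7 : a7 ≠ 0) (hm : 4*a1*a2*a3*2 - 2*a1*a7^2 ≠ 0)
    (e4 : α*(a7*c2+2*a3*c3) +c2*γ*a7 = 0) (e5 : β*(2*a2*c2+a7*c3) +c3*γ*a7=0), c2 = 0 ∧ c3 = 0 := by
    intro α β γ h0 hα hβ hγ a1 a2 a3 a7 c2 c3 h7 hm e4 e5
    have f1 : 2*a3*c3*α = β*a7*c2 := by linear_combination e4 - c2*a7*h0
    have f2 : 2*a2*c2*β = α*a7*c3 := by linear_combination e5 - c3*a7*h0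
    have f3 : c2 * c3 = 0 := by
      have : α * β*(c2*c3)*(4*a1*a2*a3*2 - 2*a1*a7^2) = 0 := by
        linear_combination 2*a1*(2*a2*c2*β)*f1 + 2*a1*β*a7*c2*f2
      simpa [hα, hβ, hm] using this
    rcases mul_eq_zero.1 f3 with h | h
    · subst h; simp [hα, h7] at f2; simp [f2]
    · subst h; simp [hβ, h7] at f1; simp [f1]
  by_cases h7 : a7 = 0 <;> by_cases h9 : a9 = 0 <;> by_cases h5 : a5 = 0
  · right
    subst h7 h9 h5
    have : a8 = 0 := by simpa [hα] using e4
    have : a10 = 0 := by simpa [hβ] using e5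
    have : a6 = 0 := by simpa [hγ] using e6
    tauto
  · left
    subst h7 h9
    have z3 : c3 = 0 := by simpa [h5] using e3
    subst z3
    have := main γ β α (by linear_combination h0) hγ hβ hα a3 a2 a1 a5 c2 c1 h5
      (by intro h; apply hm; linear_combination h)
      (by linear_combination e6 - γ * r1) (by linear_combination e5 - β * r2)
    tauto
  · left
    subst h7 h5
    have z2 : c2 = 0 := by simpa [h9] using e2
    subst z2
    have := main α γ β (by linear_combination h0) hα hγ hβ a2 a1 a3 a9 c1 c3 h9
      (by intro h; apply hm; linear_combination h)
      (by linear_combination e4 - α * r3) (by linear_combination e6 - γ * r1)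
    tauto
  · left
    have z2 : c2 = 0 := by simpa [h9] using e2
    have z3 : c3 = 0 := by simpa [h5] using e3
    have : (γ * a9) * c1 = 0 := by
      linear_combination -e4 + α * r3 + c1*a9*h0 + (γ*a7+α*a7)*z2 + 2*α*a3*z3
    simp only [mul_eq_zero, hγ, h9, false_or] at this
    tauto
  · left
    subst h9 h5
    have z1 : c1 = 0 := by simpa [h7] using e1
    subst z1
    have := main α β γ (by linear_combination h0) hα hβ hγ a1 a2 a3 a7 c2 c3 h7
      (by intro h; apply hm; linear_combination h)
      (by linear_combination e4 - α * r3) (by linear_combination e5 - β * r2)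
    tauto
  · left
    have z1 : c1 = 0 := by simpa [h7] using e1
    have z3 : c3 = 0 := by simpa [h5] using e3
    have : (β * a7) * c2 = 0 := by
      linear_combination -e4 + α * r3 + c2*a7*h0 + (β*a9+α*a9)*z1 + 2*α*a3*z3
    simp only [mul_eq_zero, hβ, h7, false_or] at this
    tauto
  · left
    have z1 : c1 = 0 := by simpa [h7] using e1
    have z2 : c2 = 0 := by simpa [h9] using e2
    have : (α * a7) * c3 = 0 := by
      linear_combination -e5 + β * r2 + c3*a7*h0 + (β*a5+α*a5)*z1 + 2*β*a2*z2
    simp only [mul_eq_zero, hα, h7, false_or] at this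
    tauto
  · left
    have z1 : c1 = 0 := by simpa [h7] using e1
    have z2 : c2 = 0 := by simpa [h9] using e2
    have z3 : c3 = 0 := by simpa [h5] using e3
    tauto

def SS (α β γ a5 a6 a7 a8 a9 a10 r1 r2 r3 r4 : ℂ) : ℂ :=
  α*(a5*r3*r4+a8*r1*r2)+β*(a9*r2*r4+a10*r1*r3)+γ*(a6*r2*r3+a7*r1*r4)

def SW (α β γ a1 a2 a3 a4 a5 a6 a7 a8 a9 a10 w1 w2 w3 w4 : ℂ) : ℂ :=
  SS α β γ a5 a6 a7 a8 a9 a10 (2*a1*w1+a5*w2+a9*w3+a6*w4) (a5*w1+2*a2*w2+a7*w3+a10*w4)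
    (a9*w1+a7*w2+2*a3*w3+a8*w4) (a6*w1+a10*w2+a8*w3+2*a4*w4)

lemma rank3 (α β γ : ℂ) (h0 : α + β + γ = 0) (hα : α ≠ 0) (hβ : β ≠ 0) (hγ : γ ≠ 0)
    (a1 a2 a3 a4 a5 a6 a7 a8 a9 a10 : ℂ)
    (hS : ∀ w1 w2 w3 w4, SW α β γ a1 a2 a3 a4 a5 a6 a7 a8 a9 a10 w1 w2 w3 w4 = 0)
    (hd : -4*a1*a10*a10*a3 + 4*a1*a10*a7*a8 + 16*a1*a2*a3*a4 - 4*a1*a2*a8*a8 - 4*a1*a4*a7*a7 + a10*a10*a9*a9 + 4*a10*a3*a5*a6 - 2*a10*a5*a8*a9 - 2*a10*a6*a7*a9 - 4*a2*a3*a6*a6 - 4*a2*a4*a9*a9 + 4*a2*a6*a8*a9 - 4*a3*a4*a5*a5 + 4*a4*a5*a7*a9 + a5*a5*a8*a8 - 2*a5*a6*a7*a8 + a6*a6*a7*a7 = 0)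
    (hm : 8*a1*a2*a3 - 2*a1*a7*a7 - 2*a2*a9*a9 - 2*a3*a5*a5 + 2*a5*a7*a9 ≠ 0) :
    a9*a10 = a6*a7 ∧ ∀ w1 w2 w3 w4, SW 0 1 (-1) a1 a2 a3 a4 a5 a6 a7 a8 a9 a10 w1 w2 w3 w4 = 0 := by
  obtain ⟨M, hM⟩ : ∃ M, M = 8*a1*a2*a3 - 2*a1*a7*a7 - 2*a2*a9*a9 - 2*a3*a5*a5 + 2*a5*a7*a9 := ⟨_, rfl⟩
  rw [← hM] at hm
  have inv : ∀ r1 r2 r3 : ℂ, ∃ w1 w2 w3 : ℂ, 2*a1*w1+a5*w2+a9*w3 = r1 ∧ a5*w1+2*a2*w2+a7*w3 = r2 ∧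
      a9*w1+a7*w2+2*a3*w3 = r3 := by
    intro r1 r2 r3
    refine ⟨((4*a2*a3-a7^2)*r1 + (a7*a9-2*a3*a5)*r2 + (a5*a7-2*a2*a9)*r3)/M,
      ((a7*a9-2*a3*a5)*r1+(4*a1*a3-a9^2)*r2+(a5*a9-2*a1*a7)*r3)/M,
      ((a5*a7-2*a2*a9)*r1+(a5*a9-2*a1*a7)*r2+(4*a1*a2-a5^2)*r3)/M, ?_, ?_, ?_⟩ <;>
    · field_simp
      rw [hM]
      ring
  obtain ⟨c1, c2, c3, q1, q2, q3⟩ := inv a6 a10 a8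
  have q4 : 2*a4 = a6*c1+a10*c2+a8*c3 := by
    have : M * (2*a4 - (a6*c1+a10*c2+a8*c3)) = 0 := by
      rw [hM]
      subst q1 q2 q3
      linear_combination hd
    rcases mul_eq_zero.1 this with h | h
    · exact absurd h hm
    · linear_combination h
  have key : ∀ r1 r2 r3 : ℂ, SS α β γ a5 a6 a7 a8 a9 a10 r1 r2 r3 (c1*r1+c2*r2+c3*r3) = 0 := by
    intro r1 r2 r3
    obtain ⟨w1, w2, w3, p1, p2, p3⟩ := inv r1 r2 r3
    have := hS w1 w2 w3 0
    unfold SW at this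
    convert this using 2
    · linear_combination -p1
    · linear_combination -p2
    · linear_combination -p3
    · linear_combination -c1*p1 -c2*p2-c3*p3 + w1 * q1 + w2*q2+w3*q3
  have k1 := key 1 0 0
  have k2 := key 0 1 0
  have k3 := key 0 0 1
  have k4 := key 1 1 0
  have k5 := key 1 0 1
  have k6 := key 0 1 1
  simp only [SS] at k1 k2 k3 k4 k5 k6
  have e1 : c1 * a7 = 0 := by
    have : γ * (c1 * a7) = 0 := by linear_combination k1
    simpa only [mul_eq_zero, hγ, false_or] using this
  have e2 : c2 * a9 = 0 := by
    have : β * (c2 * a9) = 0 := by linear_combination k2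
    simpa only [mul_eq_zero, hβ, false_or] using this
  have e3 : c3 * a5 = 0 := by
    have : α * (c3 * a5) = 0 := by linear_combination k3
    simpa only [mul_eq_zero, hα, false_or] using this
  rcases key3 α β γ h0 hα hβ hγ a1 a2 a3 a5 a6 a7 a8 a9 a10 c1 c2 c3
    (by intro h; apply hm; rw [hM]; linear_combination h) q1.symm q2.symm q3.symm e1 e2 e3
    (by linear_combination k4 - k1 - k2) (by linear_combination k5 - k1 - k3)
    (by linear_combination k6 - k2 - k3) with ⟨h1, h2, h3⟩ | ⟨h5, h6, h7, h8, h9, h10⟩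
  · subst h1 h2 h3
    have t6 : a6 = 0 := by linear_combination -q1
    have t10 : a10 = 0 := by linear_combination -q2
    have t8 : a8 = 0 := by linear_combination -q3
    have t4 : a4 = 0 := by linear_combination q4/2
    subst t6 t10 t8 t4
    refine ⟨by ring, fun w1 w2 w3 w4 => ?_⟩
    simp only [SW, SS]; ring
  · subst h5 h6 h7 h8 h9 h10
    refine ⟨by ring, fun w1 w2 w3 w4 => ?_⟩
    simp only [SW, SS]; ring

def MA (a1 a2 a3 a4 a5 a6 a7 a8 a9 a10 : ℂ) : Matrix (Fin 4) (Fin 4) ℂ :=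
  !![2*a1, a5, a9, a6; a5, 2*a2, a7, a10; a9, a7, 2*a3, a8; a6, a10, a8, 2*a4]

def MB (α β γ a5 a6 a7 a8 a9 a10 : ℂ) : Matrix (Fin 4) (Fin 4) ℂ :=
  !![0, α*a8, β*a10, γ*a7; α*a8, 0, γ*a6, β*a9; β*a10, γ*a6, 0, α*a5; γ*a7, β*a9, α*a5, 0]

lemma det_MA (a1 a2 a3 a4 a5 a6 a7 a8 a9 a10 : ℂ) : (MA a1 a2 a3 a4 a5 a6 a7 a8 a9 a10).det =
    -4*a1*a10*a10*a3 + 4*a1*a10*a7*a8 + 16*a1*a2*a3*a4 - 4*a1*a2*a8*a8 - 4*a1*a4*a7*a7 + a10*a10*a9*a9 + 4*a10*a3*a5*a6 - 2*a10*a5*a8*a9 - 2*a10*a6*a7*a9 - 4*a2*a3*a6*a6 - 4*a2*a4*a9*a9 + 4*a2*a6*a8*a9 - 4*a3*a4*a5*a5 + 4*a4*a5*a7*a9 + a5*a5*a8*a8 - 2*a5*a6*a7*a8 + a6*a6*a7*a7 := by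
  simp [MA, Matrix.det_succ_row_zero, Fin.sum_univ_succ, Fin.succAbove]
  ring

lemma rank4 (α β γ : ℂ) (hα : α ≠ 0) (hβ : β ≠ 0) (hγ : γ ≠ 0)
    (a1 a2 a3 a4 a5 a6 a7 a8 a9 a10 : ℂ)
    (hS : ∀ w1 w2 w3 w4, SW α β γ a1 a2 a3 a4 a5 a6 a7 a8 a9 a10 w1 w2 w3 w4 = 0)
    (hd : -4*a1*a10*a10*a3 + 4*a1*a10*a7*a8 + 16*a1*a2*a3*a4 - 4*a1*a2*a8*a8 - 4*a1*a4*a7*a7 + a10*a10*a9*a9 + 4*a10*a3*a5*a6 - 2*a10*a5*a8*a9 - 2*a10*a6*a7*a9 - 4*a2*a3*a6*a6 - 4*a2*a4*a9*a9 + 4*a2*a6*a8*a9 - 4*a3*a4*a5*a5 + 4*a4*a5*a7*a9 + a5*a5*a8*a8 - 2*a5*a6*a7*a8 + a6*a6*a7*a7 ≠ 0) :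
    a9*a10 = a6*a7 ∧ ∀ w1 w2 w3 w4, SW 0 1 (-1) a1 a2 a3 a4 a5 a6 a7 a8 a9 a10 w1 w2 w3 w4 = 0 := by
  rw [← det_MA] at hd
  have key : ∀ r1 r2 r3 r4 : ℂ, SS α β γ a5 a6 a7 a8 a9 a10 r1 r2 r3 r4 = 0 := by
    intro r1 r2 r3 r4
    have h : (MA a1 a2 a3 a4 a5 a6 a7 a8 a9 a10).mulVec
      ((MA a1 a2 a3 a4 a5 a6 a7 a8 a9 a10)⁻¹.mulVec ![r1, r2, r3, r4]) = ![r1, r2, r3, r4] := by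
      rw [Matrix.mulVec_mulVec, Matrix.mul_nonsing_inv _ (isUnit_iff_ne_zero.2 hd), Matrix.one_mulVec]
    generalize ((MA a1 a2 a3 a4 a5 a6 a7 a8 a9 a10)⁻¹.mulVec ![r1, r2, r3, r4]) = w at h
    have h1 := congrFun h 0
    have h2 := congrFun h 1
    have h3 := congrFun h 2
    have h4 := congrFun h 3
    simp [MA, Matrix.mulVec, dotProduct, Fin.sum_univ_four] at h1 h2 h3 h4
    have := hS (w 0) (w 1) (w 2) (w 3)
    unfold SW at this
    rwa [h1, h2, h3, h4] at this
  have k1 := key 1 1 0 0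
  have k2 := key 1 0 1 0
  have k3 := key 1 0 0 1
  have k4 := key 0 1 1 0
  have k5 := key 0 1 0 1
  have k6 := key 0 0 1 1
  simp [SS, hα, hβ, hγ] at k1 k2 k3 k4 k5 k6
  subst k1 k2 k3 k4 k5 k6
  refine ⟨by ring, fun w1 w2 w3 w4 => ?_⟩
  simp only [SW, SS]; ring

lemma classify (α β γ : ℂ) (h0 : α + β + γ = 0) (hα : α ≠ 0) (hβ : β ≠ 0) (hγ : γ ≠ 0)
    (a1 a2 a3 a4 a5 a6 a7 a8 a9 a10 : ℂ)
    (hP : α*a5*a8 + β*a9*a10 + γ*a6*a7 = 0)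
    (hS : ∀ w1 w2 w3 w4, SW α β γ a1 a2 a3 a4 a5 a6 a7 a8 a9 a10 w1 w2 w3 w4 = 0)
    (hΔ : ¬ (a9*a10 = a6*a7 ∧ ∀ w1 w2 w3 w4, SW 0 1 (-1) a1 a2 a3 a4 a5 a6 a7 a8 a9 a10 w1 w2 w3 w4 = 0)) :
    (a6 ≠ 0 ∧ 2 * a4 * a7 - a8 * a10 ≠ 0 ∧ 2 * a4 * a9 - a6 * a8 ≠ 0 ∧
      a6 * a10 - 2 * a4 * a5 ≠ 0 ∧
      a7 = -(α * a5 * a8 + β * a9 * a10) / (γ * a6) ∧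
      a1 = (a6 * (α * a9 * a10 + β * a5 * a8) + 2 * γ * a4 * a5 * a9)
        / (2 * γ * (2 * a4 * a7 - a8 * a10)) ∧
      a2 = (α * a10 * (a5 * a8 - a9 * a10) + γ * a5 * (2 * a4 * a7 - a8 * a10))
        / (2 * γ * (2 * a4 * a9 - a6 * a8)) ∧
      a3 = (β * a8 * (a5 * a8 - a9 * a10) - γ * a9 * (2 * a4 * a7 - a8 * a10))
        / (2 * γ * (a6 * a10 - 2 * a4 * a5)))
    ∨
    (a4 ≠ 0 ∧ a5 ≠ 0 ∧ a9 ≠ 0 ∧ α * a5 * a8 ^ 2 + 2 * β * a4 * a7 * a9 ≠ 0 ∧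
      a6 = 0 ∧
      a10 = -(α * a5 * a8) / (β * a9) ∧
      a1 = β * a4 * a5 * a9 ^ 2 / (α * a5 * a8 ^ 2 + 2 * β * a4 * a7 * a9) ∧
      a2 = a5 * (2 * β ^ 2 * a4 * a7 * a9 - α * γ * a5 * a8 ^ 2)
        / (4 * β ^ 2 * a4 * a9 ^ 2) ∧
      a3 = (2 * β * a4 * a7 * a9 - γ * a5 * a8 ^ 2) / (4 * β * a4 * a5)) := by
  by_cases hd : -4*a1*a10*a10*a3 + 4*a1*a10*a7*a8 + 16*a1*a2*a3*a4 - 4*a1*a2*a8*a8 - 4*a1*a4*a7*a7 + a10*a10*a9*a9 + 4*a10*a3*a5*a6 - 2*a10*a5*a8*a9 - 2*a10*a6*a7*a9 - 4*a2*a3*a6*a6 - 4*a2*a4*a9*a9 + 4*a2*a6*a8*a9 - 4*a3*a4*a5*a5 + 4*a4*a5*a7*a9 + a5*a5*a8*a8 - 2*a5*a6*a7*a8 + a6*a6*a7*a7 = 0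
  swap
  · exact absurd (rank4 α β γ hα hβ hγ a1 a2 a3 a4 a5 a6 a7 a8 a9 a10 hS hd) hΔ
  have n44 : 8*a1*a2*a3 - 2*a1*a7*a7 - 2*a2*a9*a9 - 2*a3*a5*a5 + 2*a5*a7*a9 = 0 := by
    by_contra hm
    exact hΔ (rank3 α β γ h0 hα hβ hγ a1 a2 a3 a4 a5 a6 a7 a8 a9 a10 hS hd hm)
  have n33 : -2*a1*a10*a10 + 8*a1*a2*a4 + 2*a10*a5*a6 - 2*a2*a6*a6 - 2*a4*a5*a5 = 0 := by
    by_contra hm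
    obtain ⟨h1, h2⟩ := rank3 α β γ h0 hα hβ hγ a2 a1 a4 a3 a5 a7 a6 a8 a10 a9
      (fun w1 w2 w3 w4 => by
        have := hS w2 w1 w4 w3
        simp only [SW, SS] at this ⊢; linear_combination this)
      (by linear_combination hd) (by intro h; apply hm; linear_combination h)
    exact hΔ ⟨by linear_combination h1, fun w1 w2 w3 w4 => by
        have := h2 w2 w1 w4 w3
        simp only [SW, SS] at this ⊢; linear_combination this⟩
  have n22 : 8*a1*a3*a4 - 2*a1*a8*a8 - 2*a3*a6*a6 - 2*a4*a9*a9 + 2*a6*a8*a9 = 0 := by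
    by_contra hm
    obtain ⟨h1, h2⟩ := rank3 α β γ h0 hα hβ hγ a3 a4 a1 a2 a8 a7 a6 a5 a9 a10
      (fun w1 w2 w3 w4 => by
        have := hS w3 w4 w1 w2
        simp only [SW, SS] at this ⊢; linear_combination this)
      (by linear_combination hd) (by intro h; apply hm; linear_combination h)
    exact hΔ ⟨by linear_combination h1, fun w1 w2 w3 w4 => by
        have := h2 w3 w4 w1 w2
        simp only [SW, SS] at this ⊢; linear_combination this⟩
  have n11 : -2*a10*a10*a3 + 2*a10*a7*a8 + 8*a2*a3*a4 - 2*a2*a8*a8 - 2*a4*a7*a7 = 0 := by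
    by_contra hm
    obtain ⟨h1, h2⟩ := rank3 α β γ h0 hα hβ hγ a4 a3 a2 a1 a8 a6 a7 a5 a10 a9
      (fun w1 w2 w3 w4 => by
        have := hS w4 w3 w2 w1
        simp only [SW, SS] at this ⊢; linear_combination this)
      (by linear_combination hd) (by intro h; apply hm; linear_combination h)
    exact hΔ ⟨by linear_combination h1, fun w1 w2 w3 w4 => by
        have := h2 w4 w3 w2 w1
        simp only [SW, SS] at this ⊢; linear_combination this⟩
  have n12 : -2*a10*a3*a6 + a10*a8*a9 + 4*a3*a4*a5 - 2*a4*a7*a9 - a5*a8*a8 + a6*a7*a8 = 0 := by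
    have : (-2*a10*a3*a6 + a10*a8*a9 + 4*a3*a4*a5 - 2*a4*a7*a9 - a5*a8*a8 + a6*a7*a8)^2 = 0 := by
      linear_combination (-2*a10*a10*a3 + 2*a10*a7*a8 + 8*a2*a3*a4 - 2*a2*a8*a8 - 2*a4*a7*a7) * n22 - (4*a3*a4 - a8*a8)*hd
    exact pow_eq_zero_iff (two_ne_zero) |>.1 this
  have n13 : a10*a10*a9 - a10*a5*a8 - a10*a6*a7 - 4*a2*a4*a9 + 2*a2*a6*a8 + 2*a4*a5*a7 = 0 := by
    have : (a10*a10*a9 - a10*a5*a8 - a10*a6*a7 - 4*a2*a4*a9 + 2*a2*a6*a8 + 2*a4*a5*a7)^2 = 0 := by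
      linear_combination (-2*a10*a10*a3 + 2*a10*a7*a8 + 8*a2*a3*a4 - 2*a2*a8*a8 - 2*a4*a7*a7) * n33 - (-a10*a10 + 4*a2*a4)*hd
    exact pow_eq_zero_iff (two_ne_zero) |>.1 this
  have n14 : -2*a10*a3*a5 + a10*a7*a9 + 4*a2*a3*a6 - 2*a2*a8*a9 + a5*a7*a8 - a6*a7*a7 = 0 := by
    have : (-2*a10*a3*a5 + a10*a7*a9 + 4*a2*a3*a6 - 2*a2*a8*a9 + a5*a7*a8 - a6*a7*a7)^2 = 0 := by
      linear_combination (-2*a10*a10*a3 + 2*a10*a7*a8 + 8*a2*a3*a4 - 2*a2*a8*a8 - 2*a4*a7*a7) * n44 - (4*a2*a3 - a7*a7)*hd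
    exact pow_eq_zero_iff (two_ne_zero) |>.1 this
  have n23 : -2*a1*a10*a8 + 4*a1*a4*a7 + a10*a6*a9 - 2*a4*a5*a9 + a5*a6*a8 - a6*a6*a7 = 0 := by
    have : (-2*a1*a10*a8 + 4*a1*a4*a7 + a10*a6*a9 - 2*a4*a5*a9 + a5*a6*a8 - a6*a6*a7)^2 = 0 := by
      linear_combination (8*a1*a3*a4 - 2*a1*a8*a8 - 2*a3*a6*a6 - 2*a4*a9*a9 + 2*a6*a8*a9) * n33 - (4*a1*a4 - a6*a6)*hd
    exact pow_eq_zero_iff (two_ne_zero) |>.1 this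
  have n24 : -4*a1*a10*a3 + 2*a1*a7*a8 + a10*a9*a9 + 2*a3*a5*a6 - a5*a8*a9 - a6*a7*a9 = 0 := by
    have : (-4*a1*a10*a3 + 2*a1*a7*a8 + a10*a9*a9 + 2*a3*a5*a6 - a5*a8*a9 - a6*a7*a9)^2 = 0 := by
      linear_combination (8*a1*a3*a4 - 2*a1*a8*a8 - 2*a3*a6*a6 - 2*a4*a9*a9 + 2*a6*a8*a9) * n44 - (4*a1*a3 - a9*a9)*hd
    exact pow_eq_zero_iff (two_ne_zero) |>.1 this
  have n34 : -2*a1*a10*a7 + 4*a1*a2*a8 + a10*a5*a9 - 2*a2*a6*a9 - a5*a5*a8 + a5*a6*a7 = 0 := by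
    have : (-2*a1*a10*a7 + 4*a1*a2*a8 + a10*a5*a9 - 2*a2*a6*a9 - a5*a5*a8 + a5*a6*a7)^2 = 0 := by
      linear_combination (-2*a1*a10*a10 + 8*a1*a2*a4 + 2*a10*a5*a6 - 2*a2*a6*a6 - 2*a4*a5*a5) * n44 - (4*a1*a2 - a5*a5)*hd
    exact pow_eq_zero_iff (two_ne_zero) |>.1 this
  have yz : a9*a10 - a6*a7 ≠ 0 := by
    intro h
    refine hΔ ⟨by linear_combination h, fun w1 w2 w3 w4 => ?_⟩
    simp only [SW, SS]
    linear_combination w1*w3*((-1)*n24) + w1*w4*((-1)*n23) + w2*w3*((-1)*n14) + w2*w4*((-1)*n13) +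
      (w1*(2*a1*w1+a5*w2+a9*w3+a6*w4) + w2*(a5*w1+2*a2*w2+a7*w3+a10*w4) +
    w3*(a9*w1+a7*w2+2*a3*w3+a8*w4)+w4*(a6*w1+a10*w2+a8*w3+2*a4*w4)) * h
  have xz : a5*a8 - a6*a7 ≠ 0 := by
    intro h
    have : β * (a9*a10 - a6*a7) = 0 := by linear_combination hP - α * h - a6*a7*h0
    simp only [mul_eq_zero, hβ, yz, or_self] at this
  have xy : a5*a8 - a9*a10 ≠ 0 := by
    intro h
    have : γ * (a9*a10 - a6*a7) = 0 := by linear_combination -hP + α * h + a9*a10*h0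
    simp only [mul_eq_zero, hγ, yz, or_self] at this
  have d1 : 2 * a4 * a7 - a8 * a10 ≠ 0 := by
    intro h
    apply mul_ne_zero yz xz
    linear_combination (2*a1*a7-a9*a5)*h - a7*n23
  have d2 : 2 * a4 * a9 - a6 * a8 ≠ 0 := by
    intro h
    apply mul_ne_zero yz xy
    linear_combination (a5*a7-2*a2*a9)*h - a9*n13
  have d3 : a6 * a10 - 2 * a4 * a5 ≠ 0 := by
    intro h
    apply mul_ne_zero xy xz
    linear_combination -(2*a3*a5-a9*a7)*h - a5*n12
  by_cases h6 : a6 = 0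
  · right
    subst h6
    have h4 : a4 ≠ 0 := by rintro rfl; simp at d2
    have h5 : a5 ≠ 0 := by rintro rfl; simp at d3
    have h9 : a9 ≠ 0 := by rintro rfl; simp at d2
    have hX : α * a5 * a8 ^ 2 + 2 * β * a4 * a7 * a9 ≠ 0 := by
      intro h
      apply mul_ne_zero (mul_ne_zero hβ h9) d1
      linear_combination h - a8*hP
    refine ⟨h4, h5, h9, hX, rfl, ?_, ?_, ?_, ?_⟩
    · rw [eq_div_iff (by simp [hβ, h9])]
      linear_combination hP
    · rw [eq_div_iff hX]
      linear_combination β*a9/2*n23 + a1*a8*hP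
    · rw [eq_div_iff (by simp [hβ, h9, h4])]
      linear_combination -β^2*a9*n13 + (β*a9*a10 - α*a5*a8 - β*a5*a8) * hP + α*a5^2*a8^2*h0
    · rw [eq_div_iff (by simp [hβ, h4, h5])]
      linear_combination β*n12 - a8*hP + a5*a8^2*h0
  · left
    refine ⟨h6, d1, d2, d3, ?_, ?_, ?_, ?_⟩
    · rw [eq_div_iff (by simp [hγ, h6])]
      linear_combination hP
    · rw [eq_div_iff (by simp [hγ, d1])]
      linear_combination γ*n23 + a6*hP - a6*(a5*a8+a9*a10)*h0
    · rw [eq_div_iff (by simp [hγ, d2])]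
      linear_combination -γ*n13 - a10*hP + a9*a10^2*h0
    · rw [eq_div_iff (by simp [hγ, d3])]
      linear_combination -γ*n12 + a8*hP - a5*a8^2*h0

def QW (a1 a2 a3 a4 a5 a6 a7 a8 a9 a10 C w1 w2 w3 w4 : ℂ) : ℂ :=
  a1*w1^2+a2*w2^2+a3*w3^2+a4*w4^2+a5*w1*w2+a6*w1*w4+a7*w2*w3+a8*w3*w4+a9*w1*w3+a10*w2*w4+C

lemma idem_trace (E : Matrix (Fin 4) (Fin 4) ℂ) (h : E * E = E) : ∃ r : ℕ, E.trace = r := by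
  refine ⟨Module.finrank ℂ (LinearMap.range (Matrix.toLin' E)), ?_⟩
  have hi : IsIdempotentElem (Matrix.toLin' E) := by
    unfold IsIdempotentElem
    rw [Module.End.mul_eq_comp, ← Matrix.toLin'_mul, h]
  have := (LinearMap.IsIdempotentElem.isProj_range _ hi).trace
  rw [← this]
  simp

lemma P_zero (α β γ : ℂ) (m : ℕ) (hm : 3 ≤ m)
    (a1 a2 a3 a4 a5 a6 a7 a8 a9 a10 C : ℂ)
    (hG : ∀ w1 w2 w3 w4, 2*m*(α*a5*a8 + β*a9*a10 + γ*a6*a7)*QW a1 a2 a3 a4 a5 a6 a7 a8 a9 a10 C w1 w2 w3 w4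
      = (2*m-1) * SW α β γ a1 a2 a3 a4 a5 a6 a7 a8 a9 a10 w1 w2 w3 w4) :
    α*a5*a8 + β*a9*a10 + γ*a6*a7 = 0 := by
  obtain ⟨P, hP⟩ : ∃ P, P = α*a5*a8 + β*a9*a10 + γ*a6*a7 := ⟨_, rfl⟩
  rw [← hP] at hG ⊢
  by_contra hP0
  have h0 := hG 0 0 0 0
  have h1 := hG 1 0 0 0
  have h2 := hG 0 1 0 0
  have h3 := hG 0 0 1 0
  have h4 := hG 0 0 0 1
  have h12 := hG 1 1 0 0
  have h13 := hG 1 0 1 0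
  have h14 := hG 1 0 0 1
  have h23 := hG 0 1 1 0
  have h24 := hG 0 1 0 1
  have h34 := hG 0 0 1 1
  simp only [QW, SW, SS] at h0 h1 h2 h3 h4 h12 h13 h14 h23 h24 h34
  set A := MA a1 a2 a3 a4 a5 a6 a7 a8 a9 a10 with hA
  set B := MB α β γ a5 a6 a7 a8 a9 a10 with hB
  have hm0 : (m:ℂ) ≠ 0 := by
    have : m ≠ 0 := by omega
    exact_mod_cast this
  have key : ((2*m-1 : ℂ)) • (A * B * A) = (2*m*P) • A := by
    ext i j
    fin_cases i <;> fin_cases j <;>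
      simp only [hA, hB, MA, MB, Matrix.mul_apply, Fin.sum_univ_four, Matrix.smul_apply,
        Matrix.of_apply, Matrix.cons_val, smul_eq_mul, Fin.mk_one, Fin.zero_eta, Fin.reduceFinMk]
    · linear_combination -2*(h1-h0)
    · linear_combination -(h12-h1-h2+h0)
    · linear_combination -(h13-h1-h3+h0)
    · linear_combination -(h14-h1-h4+h0)
    · linear_combination -(h12-h1-h2+h0)
    · linear_combination -2*(h2-h0)
    · linear_combination -(h23-h2-h3+h0)
    · linear_combination -(h24-h2-h4+h0)
    · linear_combination -(h13-h1-h3+h0)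
    · linear_combination -(h23-h2-h3+h0)
    · linear_combination -2*(h3-h0)
    · linear_combination -(h34-h3-h4+h0)
    · linear_combination -(h14-h1-h4+h0)
    · linear_combination -(h24-h2-h4+h0)
    · linear_combination -(h34-h3-h4+h0)
    · linear_combination -2*(h4-h0)
  have hc : (2*m*P) ≠ 0 := by simp [hm0, hP0]
  set k : ℂ := (2*m-1)/(2*m*P) with hk
  have key2 : k • (A * B * A) = A := by
    rw [hk, div_eq_inv_mul, mul_smul, key, smul_smul, inv_mul_cancel₀ hc, one_smul]
  obtain ⟨r, hr⟩ := idem_trace (k • (A * B)) (by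
    rw [smul_mul_smul_comm, mul_smul, ← Matrix.mul_assoc, ← Matrix.smul_mul, key2])
  have ht : (A * B).trace = 4 * P := by
    simp only [Matrix.trace, Matrix.diag, hA, hB, MA, MB, Matrix.mul_apply, Fin.sum_univ_four, 
        Matrix.of_apply, Matrix.cons_val]
    rw [hP]; ring
  rw [Matrix.trace_smul, ht, hk, smul_eq_mul] at hr
  have hr2 : 4 * (m:ℂ) - 2 = m * r := by
    field_simp at hr
    linear_combination hr/2
  have hr3 : 4 * m = m * r + 2 := by
    have : 4 * (m:ℂ) = m * r + 2 := by linear_combination hr2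
    exact_mod_cast this
  have : m ∣ 2 := (Nat.dvd_add_right (Dvd.intro r rfl)).1 (hr3 ▸ Dvd.intro_left 4 rfl)
  have := Nat.le_of_dvd (by norm_num) this
  omega

lemma Qpoly_eq (m : ℕ) (a1 a2 a3 a4 a5 a6 a7 a8 a9 a10 C : ℂ) (z : Fin 4 → ℂ) :
    Qpoly m a1 a2 a3 a4 a5 a6 a7 a8 a9 a10 C z =
     QW a1 a2 a3 a4 a5 a6 a7 a8 a9 a10 C (z 0 ^ m) (z 1 ^ m) (z 2 ^ m) (z 3 ^ m) := by
  unfold Qpoly QW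
  ring

lemma pow_diff (k : Fin 4) (m : ℕ) (z : Fin 4 → ℂ) :
    DifferentiableAt ℂ (fun z : Fin 4 → ℂ => z k ^ m) z := by fun_prop

lemma pd_pow (i k : Fin 4) (m : ℕ) (z : Fin 4 → ℂ) :
    pd i (fun z => z k ^ m) z = if k = i then m * z k ^ (m-1) else 0 := by
  have h := ((ContinuousLinearMap.proj (R := ℂ) (φ := fun _ : Fin 4 => ℂ) k).hasFDerivAt (x := z)).pow m
  unfold pd
  have h2 : HasFDerivAt (fun z : Fin 4 → ℂ => z k ^ m) _ z := h
  rw [h2.fderiv]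
  by_cases hk : k = i
  · subst hk; simp
  · simp [hk]

lemma pd_add (i : Fin 4) (f g : (Fin 4 → ℂ) → ℂ) (z) (hf : DifferentiableAt ℂ f z)
    (hg : DifferentiableAt ℂ g z) : pd i (fun z => f z + g z) z = pd i f z + pd i g z := by
  unfold pd; rw [fderiv_fun_add hf hg]; rfl

lemma pd_mul (i : Fin 4) (f g : (Fin 4 → ℂ) → ℂ) (z) (hf : DifferentiableAt ℂ f z)
    (hg : DifferentiableAt ℂ g z) : pd i (fun z => f z * g z) z = pd i f z * g z + f z * pd i g z := by
  unfold pd; rw [fderiv_fun_mul hf hg]; simp; ring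

lemma pd_const (i : Fin 4) (c : ℂ) (z) : pd i (fun _ => c) z = 0 := by
  unfold pd; simp

lemma pd_sum (i : Fin 4) (f : Fin 4 → (Fin 4 → ℂ) → ℂ) (z) (hf : ∀ k, DifferentiableAt ℂ (f k) z) :
    pd i (fun z => ∑ k, f k z) z = ∑ k, pd i (f k) z := by
  unfold pd; rw [fderiv_fun_sum (fun k _ => hf k)]; simp

lemma pd_fpow (i : Fin 4) (f : (Fin 4 → ℂ) → ℂ) (n : ℕ) (z) (hf : DifferentiableAt ℂ f z) :
    pd i (fun z => f z ^ n) z = n * f z ^ (n-1) * pd i f z := by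
  unfold pd; rw [(hf.hasFDerivAt.pow n).fderiv]; simp; try ring

lemma pd_congr (i : Fin 4) {f g : (Fin 4 → ℂ) → ℂ} {z} (h : f =ᶠ[nhds z] g) : pd i f z = pd i g z := by
  unfold pd; rw [h.fderiv_eq]

/-- linear form -/
noncomputable def RL (A : Matrix (Fin 4) (Fin 4) ℂ) (m : ℕ) (j : Fin 4) (z : Fin 4 → ℂ) : ℂ :=
  ∑ k, A j k * z k ^ m

lemma RL_diff (A) (m j z) : DifferentiableAt ℂ (RL A m j) z := by unfold RL; fun_prop

lemma pd_RL (A) (m j z i) : pd i (RL A m j) z = A j i * (m * z i ^ (m-1)) := by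
  unfold RL
  rw [pd_sum _ _ _ (by intro k; fun_prop)]
  have : ∀ k, pd i (fun z => A j k * z k ^ m) z = if k = i then A j k * (m * z k ^ (m-1)) else 0 := by
    intro k
    rw [pd_mul _ _ _ _ (by fun_prop) (by fun_prop), pd_const, pd_pow]
    split_ifs <;> simp
  simp [this]

lemma Qpoly_RL (m : ℕ) (a1 a2 a3 a4 a5 a6 a7 a8 a9 a10 C : ℂ) :
    Qpoly m a1 a2 a3 a4 a5 a6 a7 a8 a9 a10 C = fun z => ∑ k, (1/2 : ℂ) * (z k ^ m * RL (MA a1 a2 a3 a4 a5 a6 a7 a8 a9 a10) m k z) + C := by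
  funext z
  rw [Qpoly_eq]
  simp only [QW, RL, MA, Fin.sum_univ_four, Matrix.of_apply, Matrix.cons_val]
  ring

lemma MA_symm (a1 a2 a3 a4 a5 a6 a7 a8 a9 a10 : ℂ) (i j) : MA a1 a2 a3 a4 a5 a6 a7 a8 a9 a10 i j = MA a1 a2 a3 a4 a5 a6 a7 a8 a9 a10 j i := by
  fin_cases i <;> fin_cases j <;> rfl

lemma pd_Q (m : ℕ) (a1 a2 a3 a4 a5 a6 a7 a8 a9 a10 C : ℂ) (i z) :
    pd i (Qpoly m a1 a2 a3 a4 a5 a6 a7 a8 a9 a10 C) z = m * z i ^ (m-1) * RL (MA a1 a2 a3 a4 a5 a6 a7 a8 a9 a10) m i z := by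
  have hd := RL_diff (MA a1 a2 a3 a4 a5 a6 a7 a8 a9 a10) m
  rw [Qpoly_RL, pd_add _ _ _ _ (by fun_prop (disch := exact hd _ _)) (by fun_prop), pd_const,
    pd_sum _ _ _ (by intro k; fun_prop (disch := exact hd _ _))]
  have : ∀ k, pd i (fun z => (1/2 : ℂ) * (z k ^ m * RL (MA a1 a2 a3 a4 a5 a6 a7 a8 a9 a10) m k z)) z =
      1/2 * ((if k = i then m * z k ^ (m-1) * RL (MA a1 a2 a3 a4 a5 a6 a7 a8 a9 a10) m k z else 0) + MA a1 a2 a3 a4 a5 a6 a7 a8 a9 a10 i k * z k ^ m * (m * z i ^ (m-1))) := by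
    intro k
    rw [pd_mul _ _ _ _ (by fun_prop) (by have := hd k z; fun_prop), pd_const,
      pd_mul _ _ _ _ (by fun_prop) (hd _ _), pd_pow, pd_RL, MA_symm _ _ _ _ _ _ _ _ _ _ k i]
    split_ifs <;> ring
  simp only [this, ← Finset.mul_sum, Finset.sum_add_distrib, ← Finset.sum_mul]
  simp only [Finset.sum_ite_eq', Finset.mem_univ, if_true]
  simp only [RL]
  ring

lemma second (m : ℕ) (hm : 3 ≤ m) (a1 a2 a3 a4 a5 a6 a7 a8 a9 a10 C : ℂ)
    (U : Set (Fin 4 → ℂ)) (hU : IsOpen U) 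
    (u : (Fin 4 → ℂ) → ℂ) (hu : ContDiffOn ℂ 2 u U)
    (hsol : ∀ z ∈ U, u z ^ (2 * m) = Qpoly m a1 a2 a3 a4 a5 a6 a7 a8 a9 a10 C z)
    (i j : Fin 4) (hij : i ≠ j) (z : Fin 4 → ℂ) (hz : z ∈ U) :
    (2*m)^2 * u z ^ (4*m-1) * pd i (pd j u) z = m^2 * (z i ^ (m-1) * z j ^ (m-1)) *
      (2*m*Qpoly m a1 a2 a3 a4 a5 a6 a7 a8 a9 a10 C z * MA a1 a2 a3 a4 a5 a6 a7 a8 a9 a10 i j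
       - (2*m-1) * (RL (MA a1 a2 a3 a4 a5 a6 a7 a8 a9 a10) m i z * RL (MA a1 a2 a3 a4 a5 a6 a7 a8 a9 a10) m j z)) := by
  have hA := MA_symm a1 a2 a3 a4 a5 a6 a7 a8 a9 a10 j i
  have hQ := pd_Q m a1 a2 a3 a4 a5 a6 a7 a8 a9 a10 C
  have hsz := hsol z hz
  generalize MA a1 a2 a3 a4 a5 a6 a7 a8 a9 a10 = A at *
  generalize Qpoly m a1 a2 a3 a4 a5 a6 a7 a8 a9 a10 C = Q at *
  have hd : ∀ z ∈ U, DifferentiableAt ℂ u z := fun z hz =>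
    (hu.contDiffAt (hU.mem_nhds hz)).differentiableAt (by norm_num)
  have hd2 : ∀ k, ∀ z ∈ U, DifferentiableAt ℂ (pd k u) z := fun k z hz => by
    have h1 : ContDiffAt ℂ 1 (fderiv ℂ u) z :=
      (hu.contDiffAt (hU.mem_nhds hz)).fderiv_right (by norm_num)
    have := h1.differentiableAt (by norm_num)
    unfold pd
    fun_prop
  have first : ∀ k, ∀ z ∈ U, ((2*m : ℕ) : ℂ) * u z ^ (2*m-1) * pd k u z = m * z k ^ (m-1) * RL A m k z := by
    intro k z hz
    rw [← pd_fpow _ _ _ _ (hd z hz), ← hQ]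
    apply pd_congr
    filter_upwards [hU.mem_nhds hz] with y hy using hsol y hy
  have sec : pd i (fun z => ((2*m : ℕ) : ℂ) * u z ^ (2*m-1) * pd j u z) z = pd i (fun z => m * z j ^ (m-1) * RL A m j z) z := by
    apply pd_congr
    filter_upwards [hU.mem_nhds hz] with y hy using first j y hy
  have hdz := hd z hz
  rw [pd_mul _ _ _ _ (by fun_prop) (hd2 _ _ hz), pd_mul _ _ _ _ (by fun_prop) (by fun_prop), pd_const,
    pd_fpow _ _ _ _ hdz, pd_mul _ _ _ _ (by fun_prop) (RL_diff _ _ _ _), pd_RL, pd_mul _ _ _ _ (by fun_prop) (by fun_prop),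
    pd_const, pd_pow, if_neg hij.symm] at sec
  have f1 := first i z hz
  have f2 := first j z hz
  obtain ⟨n, rfl⟩ : ∃ n, m = n + 1 := ⟨m-1, by omega⟩
  rw [show 4*(n+1)-1 = (2*n+1) + (2*n+2) by omega]
  rw [show 2*(n+1)-1-1 = 2*n by omega] at sec
  rw [show 2*(n+1)-1 = 2*n+1 by omega] at sec f1 f2
  rw [show 2*(n+1) = 2*n+2 by omega] at hsz sec f1 f2
  rw [show n+1-1 = n by omega] at *
  rw [← hsz]
  push_cast at *
  rw [hA] at sec
  linear_combination (2*(n+1) : ℂ)*u z^(2*n+2) * sec - (2*n+1)*(2 * (n+1) * u z^(2*n+1) * pd i u z * f2 + (n+1)*z j ^ n * RL A (n+1) j z * f1)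

lemma combine (α β γ : ℂ) (h0 : α + β + γ = 0) (m : ℕ) (hm : 3 ≤ m) (a1 a2 a3 a4 a5 a6 a7 a8 a9 a10 C : ℂ)
    (U : Set (Fin 4 → ℂ)) (hU : IsOpen U)
    (u : (Fin 4 → ℂ) → ℂ) (hu : ContDiffOn ℂ 2 u U)
    (hsol : ∀ z ∈ U, u z ^ (2 * m) = Qpoly m a1 a2 a3 a4 a5 a6 a7 a8 a9 a10 C z)
    (z : Fin 4 → ℂ) (hz : z ∈ U) :
    ((2*m)^2 * u z ^ (4*m-1))^2 * (α * pd 0 (pd 1 u) z * pd 2 (pd 3 u) z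
        + β * pd 0 (pd 2 u) z * pd 1 (pd 3 u) z
        + γ * pd 0 (pd 3 u) z * pd 1 (pd 2 u) z) =
    m^4 * (z 0 ^ (m-1) * z 1 ^ (m-1) * z 2 ^ (m-1) * z 3 ^ (m-1)) * (2*m) *
      Qpoly m a1 a2 a3 a4 a5 a6 a7 a8 a9 a10 C z *
      (2*m*(α*a5*a8 + β*a9*a10 + γ*a6*a7)*
        QW a1 a2 a3 a4 a5 a6 a7 a8 a9 a10 C (z 0 ^ m) (z 1 ^ m) (z 2 ^ m) (z 3 ^ m) -
      (2*m-1) * SW α β γ a1 a2 a3 a4 a5 a6 a7 a8 a9 a10 (z 0 ^ m) (z 1 ^ m) (z 2 ^ m) (z 3 ^ m)) := by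
  have s := second m hm a1 a2 a3 a4 a5 a6 a7 a8 a9 a10 C U hU u hu hsol
  have s01 := s 0 1 (by decide) z hz
  have s02 := s 0 2 (by decide) z hz
  have s03 := s 0 3 (by decide) z hz
  have s12 := s 1 2 (by decide) z hz
  have s13 := s 1 3 (by decide) z hz
  have s23 := s 2 3 (by decide) z hz
  rw [← Qpoly_eq]
  generalize Qpoly m a1 a2 a3 a4 a5 a6 a7 a8 a9 a10 C z = Q at *
  generalize (2*m)^2 * u z ^ (4*m-1) = κ at *
  have e : SW α β γ a1 a2 a3 a4 a5 a6 a7 a8 a9 a10 (z 0 ^ m) (z 1 ^ m) (z 2 ^ m) (z 3 ^ m) =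
    SS α β γ a5 a6 a7 a8 a9 a10 (RL (MA a1 a2 a3 a4 a5 a6 a7 a8 a9 a10) m 0 z)
      (RL (MA a1 a2 a3 a4 a5 a6 a7 a8 a9 a10) m 1 z) (RL (MA a1 a2 a3 a4 a5 a6 a7 a8 a9 a10) m 2 z)
      (RL (MA a1 a2 a3 a4 a5 a6 a7 a8 a9 a10) m 3 z) := by
    simp only [SW, RL, MA, Fin.sum_univ_four, Matrix.of_apply, Matrix.cons_val]
  rw [e]
  have m01 : MA a1 a2 a3 a4 a5 a6 a7 a8 a9 a10 0 1 = a5 := rfl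
  have m02 : MA a1 a2 a3 a4 a5 a6 a7 a8 a9 a10 0 2 = a9 := rfl
  have m03 : MA a1 a2 a3 a4 a5 a6 a7 a8 a9 a10 0 3 = a6 := rfl
  have m12 : MA a1 a2 a3 a4 a5 a6 a7 a8 a9 a10 1 2 = a7 := rfl
  have m13 : MA a1 a2 a3 a4 a5 a6 a7 a8 a9 a10 1 3 = a10 := rfl
  have m23 : MA a1 a2 a3 a4 a5 a6 a7 a8 a9 a10 2 3 = a8 := rfl
  rw [m01] at s01
  rw [m02] at s02
  rw [m03] at s03
  rw [m12] at s12
  rw [m13] at s13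
  rw [m23] at s23
  generalize RL (MA a1 a2 a3 a4 a5 a6 a7 a8 a9 a10) m 0 z = r0 at *
  generalize RL (MA a1 a2 a3 a4 a5 a6 a7 a8 a9 a10) m 1 z = r1 at *
  generalize RL (MA a1 a2 a3 a4 a5 a6 a7 a8 a9 a10) m 2 z = r2 at *
  generalize RL (MA a1 a2 a3 a4 a5 a6 a7 a8 a9 a10) m 3 z = r3 at *
  generalize z 0 ^ (m-1) = p0 at *
  generalize z 1 ^ (m-1) = p1 at *
  generalize z 2 ^ (m-1) = p2 at *
  generalize z 3 ^ (m-1) = p3 at *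
  unfold SS
  have hγ : γ = -α - β := by linear_combination h0
  subst hγ
  have t : ∀ A B : ℂ, κ^2 * (A * B) = (κ * A) * (κ * B) := by intro A B; ring
  calc _ = α * ((κ * pd 0 (pd 1 u) z) * (κ * pd 2 (pd 3 u) z)) +
        β * ((κ * pd 0 (pd 2 u) z) * (κ * pd 1 (pd 3 u) z)) +
        (-α - β) * ((κ * pd 0 (pd 3 u) z) * (κ * pd 1 (pd 2 u) z)) := by ring
    _ = _ := by
      rw [s01, s02, s03, s12, s13, s23]
      ring

/-- Theorem 1 of the paper: any algebraic solution `u^{2m} = Q(z)` (with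
`m ≥ 3`) of the general heavenly equation with `Δ = u₁₃u₂₄ − u₁₄u₂₃` not identically zero
has coefficients given by one of the two families (\ref{sol1}) or (\ref{sol2}), in each
case with nonvanishing denominators. -/
theorem algebraic_solution_classification
    (α β γ : ℂ) (hαβγ : α + β + γ = 0)
    (hα : α ≠ 0) (hβ : β ≠ 0) (hγ : γ ≠ 0)
    (m : ℕ) (hm : 3 ≤ m)
    (a1 a2 a3 a4 a5 a6 a7 a8 a9 a10 C : ℂ)
    (U : Set (Fin 4 → ℂ)) (hU : IsOpen U) (hUne : U.Nonempty) (hUconn : IsConnected U)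
    (u : (Fin 4 → ℂ) → ℂ) (hu : ContDiffOn ℂ 2 u U)
    (hne : ∀ z ∈ U, u z ≠ 0)
    (hsol : ∀ z ∈ U, u z ^ (2 * m) = Qpoly m a1 a2 a3 a4 a5 a6 a7 a8 a9 a10 C z)
    (heav : ∀ z ∈ U,
      α * pd 0 (pd 1 u) z * pd 2 (pd 3 u) z
        + β * pd 0 (pd 2 u) z * pd 1 (pd 3 u) z
        + γ * pd 0 (pd 3 u) z * pd 1 (pd 2 u) z = 0)
    (hΔ : ∃ z ∈ U,
      pd 0 (pd 2 u) z * pd 1 (pd 3 u) z - pd 0 (pd 3 u) z * pd 1 (pd 2 u) z ≠ 0) :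
    -- family (i)
    (a6 ≠ 0 ∧ 2 * a4 * a7 - a8 * a10 ≠ 0 ∧ 2 * a4 * a9 - a6 * a8 ≠ 0 ∧
      a6 * a10 - 2 * a4 * a5 ≠ 0 ∧
      a7 = -(α * a5 * a8 + β * a9 * a10) / (γ * a6) ∧
      a1 = (a6 * (α * a9 * a10 + β * a5 * a8) + 2 * γ * a4 * a5 * a9)
        / (2 * γ * (2 * a4 * a7 - a8 * a10)) ∧
      a2 = (α * a10 * (a5 * a8 - a9 * a10) + γ * a5 * (2 * a4 * a7 - a8 * a10))
        / (2 * γ * (2 * a4 * a9 - a6 * a8)) ∧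
      a3 = (β * a8 * (a5 * a8 - a9 * a10) - γ * a9 * (2 * a4 * a7 - a8 * a10))
        / (2 * γ * (a6 * a10 - 2 * a4 * a5)))
    ∨
    -- family (ii)
    (a4 ≠ 0 ∧ a5 ≠ 0 ∧ a9 ≠ 0 ∧ α * a5 * a8 ^ 2 + 2 * β * a4 * a7 * a9 ≠ 0 ∧
      a6 = 0 ∧
      a10 = -(α * a5 * a8) / (β * a9) ∧
      a1 = β * a4 * a5 * a9 ^ 2 / (α * a5 * a8 ^ 2 + 2 * β * a4 * a7 * a9) ∧
      a2 = a5 * (2 * β ^ 2 * a4 * a7 * a9 - α * γ * a5 * a8 ^ 2)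
        / (4 * β ^ 2 * a4 * a9 ^ 2) ∧
      a3 = (2 * β * a4 * a7 * a9 - γ * a5 * a8 ^ 2) / (4 * β * a4 * a5)) := by
  have comb := fun (α β γ : ℂ) (h0 : α + β + γ = 0) => combine α β γ h0 m hm a1 a2 a3 a4 a5 a6 a7 a8 a9 a10 C U hU u hu hsol
  obtain ⟨z0, hz0, hΔ0⟩ := hΔ
  have hm0 : (m:ℂ) ≠ 0 := by
    have : m ≠ 0 := by omega
    exact_mod_cast this
  have hκ : ((2*m)^2 * u z0 ^ (4*m-1))^2 ≠ 0 := by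
    have := hne z0 hz0
    simp [hm0, this]
  have c1 := comb 0 1 (-1) (by ring) z0 hz0
  have hne1 : ((2*m)^2 * u z0 ^ (4*m-1))^2 * (0 * pd 0 (pd 1 u) z0 * pd 2 (pd 3 u) z0
        + 1 * pd 0 (pd 2 u) z0 * pd 1 (pd 3 u) z0
        + (-1) * pd 0 (pd 3 u) z0 * pd 1 (pd 2 u) z0) ≠ 0 := by
    apply mul_ne_zero hκ
    intro h
    apply hΔ0
    linear_combination h
  rw [c1] at hne1
  have hx := right_ne_zero_of_mul hne1
  have hp := right_ne_zero_of_mul (left_ne_zero_of_mul (left_ne_zero_of_mul (left_ne_zero_of_mul hne1)))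
  have hev : ∀ᶠ z in nhds z0, z ∈ U ∧ z 0 ^ (m-1) * z 1 ^ (m-1) * z 2 ^ (m-1) * z 3 ^ (m-1) ≠ 0 := by
    refine Filter.Eventually.and (hU.mem_nhds hz0) ?_
    have hc : Continuous (fun z : Fin 4 → ℂ => z 0 ^ (m-1) * z 1 ^ (m-1) * z 2 ^ (m-1) * z 3 ^ (m-1)) := by
      fun_prop
    exact hc.continuousAt.eventually_ne hp
  have hG0 : (fun z : Fin 4 → ℂ => 2*m*(α*a5*a8 + β*a9*a10 + γ*a6*a7)*
        QW a1 a2 a3 a4 a5 a6 a7 a8 a9 a10 C (z 0 ^ m) (z 1 ^ m) (z 2 ^ m) (z 3 ^ m) -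
      (2*m-1) * SW α β γ a1 a2 a3 a4 a5 a6 a7 a8 a9 a10 (z 0 ^ m) (z 1 ^ m) (z 2 ^ m) (z 3 ^ m))
      = fun _ => 0 := by
    refine AnalyticOnNhd.eq_of_eventuallyEq (𝕜 := ℂ) (z₀ := z0) ?_ (fun _ _ => analyticAt_const) ?_
    · rw [← contDiff_omega_iff_analyticOnNhd]
      unfold QW SW SS
      fun_prop
    · filter_upwards [hev] with z hz
      have h1 := comb α β γ hαβγ z hz.1
      rw [heav z hz.1, mul_zero] at h1
      have hQ : Qpoly m a1 a2 a3 a4 a5 a6 a7 a8 a9 a10 C z ≠ 0 := by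
        rw [← hsol z hz.1]
        exact pow_ne_zero _ (hne z hz.1)
      refine (mul_eq_zero.1 h1.symm).resolve_left ?_
      refine mul_ne_zero (mul_ne_zero (mul_ne_zero (pow_ne_zero _ hm0) hz.2) ?_) hQ
      exact mul_ne_zero two_ne_zero hm0
  have hG : ∀ w1 w2 w3 w4, 2*m*(α*a5*a8 + β*a9*a10 + γ*a6*a7)*QW a1 a2 a3 a4 a5 a6 a7 a8 a9 a10 C w1 w2 w3 w4
      = (2*m-1) * SW α β γ a1 a2 a3 a4 a5 a6 a7 a8 a9 a10 w1 w2 w3 w4 := by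
    intro w1 w2 w3 w4
    obtain ⟨y1, rfl⟩ := IsAlgClosed.exists_pow_nat_eq w1 (show 0 < m by omega)
    obtain ⟨y2, rfl⟩ := IsAlgClosed.exists_pow_nat_eq w2 (show 0 < m by omega)
    obtain ⟨y3, rfl⟩ := IsAlgClosed.exists_pow_nat_eq w3 (show 0 < m by omega)
    obtain ⟨y4, rfl⟩ := IsAlgClosed.exists_pow_nat_eq w4 (show 0 < m by omega)
    have := congrFun hG0 ![y1, y2, y3, y4]
    exact sub_eq_zero.1 this
  have hP := P_zero α β γ m hm a1 a2 a3 a4 a5 a6 a7 a8 a9 a10 C hG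
  have h2m : (2*m-1 : ℂ) ≠ 0 := by
    intro h
    have h2 : ((2*m : ℕ) : ℂ) = (1 : ℕ) := by push_cast; linear_combination h
    have h3 : 2*m = 1 := by exact_mod_cast h2
    omega
  have hS : ∀ w1 w2 w3 w4, SW α β γ a1 a2 a3 a4 a5 a6 a7 a8 a9 a10 w1 w2 w3 w4 = 0 := by
    intro w1 w2 w3 w4
    have := hG w1 w2 w3 w4
    rw [hP, mul_zero, zero_mul] at this
    exact (mul_eq_zero.1 this.symm).resolve_left h2m
  refine classify α β γ hαβγ hα hβ hγ a1 a2 a3 a4 a5 a6 a7 a8 a9 a10 hP hS ?_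
  rintro ⟨h1, h2⟩
  apply hx
  rw [h2]
  linear_combination (2*m*QW a1 a2 a3 a4 a5 a6 a7 a8 a9 a10 C (z0 0 ^ m) (z0 1 ^ m) (z0 2 ^ m) (z0 3 ^ m)) * h1
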